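/- Fix m ≥ 1 and n ≥ 2. Let a^1, …, a^{n−2}, b ∈ A(m), let S be a Lebesgue-measurable subset of [0,1]^2 with S ∩ S_b = ∅ (so that χ_b χ_S = 0), and let χ_S be the characteristic function of S. Then, with respect to Lebesgue measure on [0,1]^2, E_n(χ_{a^1}, …, χ_{a^{n−2}}, χ_b, χ_S) ≤ 0. -/

import Mathlib

open MeasureTheory

/-- The orbits (cycles, counting fixed points as 1-cycles) of a permutation `σ`
of a finite index type, as a finset of finsets. -/
def permOrbits {ι : Type*} [Fintype ι] [DecidableEq ι] (σ : Equiv.Perm ι) : Finset (Finset ι) :=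
  Finset.univ.image fun x => Finset.univ.filter fun y => σ.SameCycle x y

/-- `E_σ(f¹,…,fⁿ) = ∏_{O orbit of σ} E(∏_{i ∈ O} fⁱ)`, the expectation being the
integral with respect to `μ`. -/
noncomputable def permE {Ω : Type*} [MeasurableSpace Ω] (μ : Measure Ω)
    {ι : Type*} [Fintype ι] [DecidableEq ι] (f : ι → Ω → ℝ) (σ : Equiv.Perm ι) : ℝ :=
  ∏ O ∈ permOrbits σ, ∫ ω, (∏ i ∈ O, f i ω) ∂μ

/-- Sahi's functional `E_n(f¹,…,fⁿ) = ∑_{σ ∈ S_n} (−1)^{C_σ − 1} E_σ(f¹,…,fⁿ)`,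
where `C_σ` is the number of orbits of `σ`. -/
noncomputable def En {Ω : Type*} [MeasurableSpace Ω] (μ : Measure Ω)
    {ι : Type*} [Fintype ι] [DecidableEq ι] (f : ι → Ω → ℝ) : ℝ :=
  ∑ σ : Equiv.Perm ι, (-1 : ℝ) ^ ((permOrbits σ).card - 1) * permE μ f σ

/-- `a` belongs to `A(m)`: integer sequences with `m ≥ a_1 ≥ ⋯ ≥ a_m ≥ 0`. -/
def memA (m : ℕ) (a : Fin m → ℤ) : Prop :=
  (∀ j, 0 ≤ a j) ∧ (∀ j, a j ≤ (m : ℤ)) ∧ Antitone a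

/-- The monotone subset `S_a ⊆ [0,1]²` attached to `a ∈ A(m)`: the union of the closed
squares `D_{i,j} = [(i−1)/m, i/m] × [(j−1)/m, j/m]` over (1-based) pairs `(i,j)` with
`1 ≤ i ≤ m` and `1 ≤ j ≤ aᵢ`.  Here `i, j : Fin m` are 0-based. -/
def Sa (m : ℕ) (a : Fin m → ℤ) : Set (Fin 2 → ℝ) :=
  ⋃ (i : Fin m) (j : Fin m) (_ : (j.val : ℤ) + 1 ≤ a i),
    Set.Icc ![(i.val : ℝ) / m, (j.val : ℝ) / m]
      ![((i.val : ℝ) + 1) / m, ((j.val : ℝ) + 1) / m]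

/-- The signed sum `∑_σ (−1)^{C_σ} E_σ(f)`; it is `-E_n` on nonempty index types. -/
noncomputable def cycleSum {Ω : Type*} [MeasurableSpace Ω] (μ : Measure Ω)
    {ι : Type*} [Fintype ι] [DecidableEq ι] (f : ι → Ω → ℝ) : ℝ :=
  ∑ σ : Equiv.Perm ι, (-1 : ℝ) ^ (permOrbits σ).card * permE μ f σ

section Permutations

set_option linter.unusedSectionVars false

variable {ι κ : Type*} [Fintype ι] [DecidableEq ι] [Fintype κ] [DecidableEq κ]

lemma mem_permOrbits {σ : Equiv.Perm ι} {O : Finset ι} :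
    O ∈ permOrbits σ ↔ ∃ x, Finset.univ.filter (fun y => σ.SameCycle x y) = O := by
  simp [permOrbits]

lemma sameCycle_map_of_step {σ : Equiv.Perm ι} {τ : Equiv.Perm κ} (r : ι → κ)
    (h : ∀ x, τ.SameCycle (r x) (r (σ x))) {x y : ι} (hxy : σ.SameCycle x y) :
    τ.SameCycle (r x) (r y) := by
  obtain ⟨i, rfl⟩ := hxy.exists_nat_pow_eq
  clear hxy
  induction i with
  | zero => exact Equiv.Perm.SameCycle.refl _ _
  | succ i ih =>
    rw [pow_succ', Equiv.Perm.mul_apply]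
    exact ih.trans (h _)

lemma permOrbits_eq_image {σ : Equiv.Perm ι} {τ : Equiv.Perm κ} (r : ι → κ)
    (hr : Function.Surjective r)
    (h : ∀ x y, σ.SameCycle x y ↔ τ.SameCycle (r x) (r y)) :
    permOrbits σ = (permOrbits τ).image fun O => Finset.univ.filter fun x => r x ∈ O := by
  ext O
  simp only [mem_permOrbits, Finset.mem_image]
  constructor
  · rintro ⟨x, rfl⟩
    exact ⟨_, ⟨r x, rfl⟩, by ext y; simp [h]⟩
  · rintro ⟨_, ⟨z, rfl⟩, rfl⟩
    obtain ⟨x, rfl⟩ := hr z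
    exact ⟨x, by ext y; simp [h]⟩

lemma filter_mem_injective (r : ι → κ) (hr : Function.Surjective r) :
    Function.Injective fun O : Finset κ => Finset.univ.filter fun x => r x ∈ O := by
  intro O O' hO
  ext z
  obtain ⟨x, rfl⟩ := hr z
  have := congrArg (x ∈ ·) hO
  simpa using this

variable {Ω : Type*} [MeasurableSpace Ω] (μ : Measure Ω)

lemma permOrbits_card_eq {σ : Equiv.Perm ι} {τ : Equiv.Perm κ} (r : ι → κ)
    (hr : Function.Surjective r)
    (h : ∀ x y, σ.SameCycle x y ↔ τ.SameCycle (r x) (r y)) :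
    (permOrbits σ).card = (permOrbits τ).card := by
  rw [permOrbits_eq_image r hr h, Finset.card_image_of_injective _ (filter_mem_injective r hr)]

lemma permE_eq_fiberwise {σ : Equiv.Perm ι} {τ : Equiv.Perm κ} (r : ι → κ)
    (hr : Function.Surjective r)
    (h : ∀ x y, σ.SameCycle x y ↔ τ.SameCycle (r x) (r y)) (f : ι → Ω → ℝ)
    (g : κ → Ω → ℝ) (hg : ∀ j ω, g j ω = ∏ i with r i = j, f i ω) :
    permE μ f σ = permE μ g τ := by
  unfold permE
  rw [permOrbits_eq_image r hr h,
    Finset.prod_image fun _ _ _ _ hO => filter_mem_injective r hr hO]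
  refine Finset.prod_congr rfl fun O _ => ?_
  congr 1
  ext ω
  rw [← Finset.prod_fiberwise_of_maps_to (t := O) (g := r) (by simp)]
  refine Finset.prod_congr rfl fun j hj => ?_
  rw [hg]
  refine Finset.prod_congr ?_ fun _ _ => rfl
  ext x
  simp only [Finset.mem_filter, Finset.mem_univ, true_and]
  constructor
  · rintro ⟨_, rfl⟩; rfl
  · rintro rfl; exact ⟨hj, rfl⟩

lemma cycleSum_comp_equiv (e : ι ≃ κ) (f : κ → Ω → ℝ) :
    cycleSum μ (fun i => f (e i)) = cycleSum μ f := by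
  unfold cycleSum
  refine Fintype.sum_equiv e.permCongr _ _ fun σ => ?_
  have h : ∀ x y, σ.SameCycle x y ↔ (e.permCongr σ).SameCycle (e x) (e y) := by
    intro x y
    constructor
    · refine sameCycle_map_of_step e fun z => ?_
      have : e (σ z) = (e.permCongr σ) (e z) := by simp
      rw [this]
      exact Equiv.Perm.sameCycle_apply_right.2 (Equiv.Perm.SameCycle.refl _ _)
    · intro hxy
      have := sameCycle_map_of_step (τ := σ) e.symm (fun z => ?_) hxy
      · simpa using this
      · simp [Equiv.permCongr_apply, Equiv.Perm.SameCycle.refl]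
  rw [permOrbits_card_eq e e.surjective h,
    permE_eq_fiberwise μ e e.surjective h _ f fun j ω => ?_]
  rw [Finset.prod_eq_single (e.symm j)] <;> simp +contextual [Equiv.eq_symm_apply]

lemma sameCycle_optionCongr_some (σ : Equiv.Perm ι) (x y : ι) :
    Equiv.Perm.SameCycle (Equiv.optionCongr σ) (some x) (some y) ↔ σ.SameCycle x y := by
  constructor
  · intro h
    refine sameCycle_map_of_step (fun z : Option ι => z.getD x) (fun z => ?_) h
    cases z <;> simp [Equiv.Perm.SameCycle.refl]
  · refine sameCycle_map_of_step some fun z => ?_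
    have : some (σ z) = Equiv.optionCongr σ (some z) := by simp
    rw [this]
    exact Equiv.Perm.sameCycle_apply_right.2 (Equiv.Perm.SameCycle.refl _ _)

lemma sameCycle_optionCongr_none (σ : Equiv.Perm ι) (y : Option ι) :
    Equiv.Perm.SameCycle (Equiv.optionCongr σ) none y ↔ y = none := by
  constructor
  · rintro ⟨i, rfl⟩
    exact Equiv.Perm.zpow_apply_eq_self_of_apply_eq_self (by simp) i
  · rintro rfl; exact Equiv.Perm.SameCycle.refl _ _

lemma permOrbits_optionCongr (σ : Equiv.Perm ι) :
    permOrbits (Equiv.optionCongr σ) =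
      insert {none} ((permOrbits σ).image fun O => O.map Function.Embedding.some) := by
  ext O
  simp only [mem_permOrbits, Finset.mem_insert, Finset.mem_image]
  have hnone : (Finset.univ.filter fun y => Equiv.Perm.SameCycle (Equiv.optionCongr σ) none y) = {none} := by
    ext y; simp [sameCycle_optionCongr_none]
  have hsome : ∀ x, (Finset.univ.filter fun y => Equiv.Perm.SameCycle (Equiv.optionCongr σ) (some x) y) =
      (Finset.univ.filter fun y => σ.SameCycle x y).map Function.Embedding.some := by
    intro x
    ext y
    cases y with
    | none =>
      simp [Equiv.Perm.sameCycle_comm (x := some x), sameCycle_optionCongr_none]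
    | some y => simp [sameCycle_optionCongr_some]
  constructor
  · rintro ⟨x, rfl⟩
    cases x with
    | none => exact Or.inl hnone
    | some x => exact Or.inr ⟨_, ⟨x, rfl⟩, (hsome x).symm⟩
  · rintro (rfl | ⟨_, ⟨x, rfl⟩, rfl⟩)
    · exact ⟨none, hnone⟩
    · exact ⟨some x, hsome x⟩

lemma singleton_none_notMem_image (s : Finset (Finset ι)) :
    ({none} : Finset (Option ι)) ∉ s.image fun O => O.map Function.Embedding.some := by
  simp only [Finset.mem_image, not_exists, not_and]
  intro O _ h
  have : none ∈ O.map Function.Embedding.some := by rw [h]; simp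
  simp at this

lemma permOrbits_optionCongr_card (σ : Equiv.Perm ι) :
    (permOrbits (Equiv.optionCongr σ)).card = (permOrbits σ).card + 1 := by
  rw [permOrbits_optionCongr, Finset.card_insert_of_notMem (singleton_none_notMem_image _),
    Finset.card_image_of_injective _ (Finset.map_injective _)]

lemma permE_optionCongr (σ : Equiv.Perm ι) (f : Option ι → Ω → ℝ) :
    permE μ f (Equiv.optionCongr σ) =
      (∫ ω, f none ω ∂μ) * permE μ (fun i => f (some i)) σ := by
  unfold permE
  rw [permOrbits_optionCongr, Finset.prod_insert (singleton_none_notMem_image _),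
    Finset.prod_image fun _ _ _ _ h => Finset.map_injective _ h]
  simp

lemma sameCycle_swap_mul_optionCongr (σ : Equiv.Perm ι) (a : ι) (x y : Option ι) :
    (Equiv.swap none (some a) * Equiv.optionCongr σ).SameCycle x y ↔
      σ.SameCycle (x.getD a) (y.getD a) := by
  set τ := Equiv.swap none (some a) * Equiv.optionCongr σ with hτ
  have hnone : τ none = some a := by simp [hτ]
  have hsome : ∀ z, τ (some z) = if σ z = a then none else some (σ z) := by
    intro z
    split_ifs with h
    · simp [hτ, h]
    · simp [hτ, Equiv.swap_apply_of_ne_of_ne, h]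
  have step : ∀ z, τ.SameCycle z (τ z) := fun z =>
    Equiv.Perm.sameCycle_apply_right.2 (Equiv.Perm.SameCycle.refl _ _)
  have hget : ∀ z : Option ι, τ.SameCycle (some (z.getD a)) z := by
    intro z
    cases z with
    | none => simpa [hnone] using (step none).symm
    | some z => exact Equiv.Perm.SameCycle.refl _ _
  constructor
  · refine sameCycle_map_of_step (fun z : Option ι => z.getD a) fun z => ?_
    cases z with
    | none => simp [hnone, Equiv.Perm.SameCycle.refl]
    | some z =>
      rw [hsome]
      split_ifs with h
      · simp [← h, Equiv.Perm.SameCycle.refl]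
      · simp [Equiv.Perm.SameCycle.refl]
  · intro h
    have := sameCycle_map_of_step (τ := τ) some (fun z => ?_) h
    · exact ((hget x).symm.trans this).trans (hget y)
    · have h1 := step (some z)
      rw [hsome] at h1
      split_ifs at h1 with h2
      · rw [h2]
        exact h1.trans (by simpa [hnone] using step none)
      · exact h1

/-- Inserting one more function: it either forms a cycle of its own, or is merged with one of
the other functions. -/
lemma cycleSum_option (f : Option ι → Ω → ℝ) :
    cycleSum μ f = -(∫ ω, f none ω ∂μ) * cycleSum μ (fun i => f (some i)) +
      ∑ a, cycleSum μ (Function.update (fun i => f (some i)) a fun ω => f (some a) ω * f none ω) := by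
  unfold cycleSum
  rw [← Equiv.sum_comp Equiv.Perm.decomposeOption.symm, Fintype.sum_prod_type, Fintype.sum_option]
  congr 1
  · rw [Finset.mul_sum]
    refine Finset.sum_congr rfl fun σ _ => ?_
    simp only [Equiv.Perm.decomposeOption_symm_apply, Equiv.swap_self]
    have : (Equiv.refl (Option ι) : Equiv.Perm (Option ι)) * Equiv.optionCongr σ
      = Equiv.optionCongr σ := one_mul _
    rw [this, permOrbits_optionCongr_card, permE_optionCongr]
    ring
  · refine Finset.sum_congr rfl fun a _ => Finset.sum_congr rfl fun σ _ => ?_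
    simp only [Equiv.Perm.decomposeOption_symm_apply]
    have hr : Function.Surjective fun z : Option ι => z.getD a := fun z => ⟨some z, rfl⟩
    rw [permOrbits_card_eq _ hr (sameCycle_swap_mul_optionCongr σ a),
      permE_eq_fiberwise μ _ hr (sameCycle_swap_mul_optionCongr σ a) f _ fun j ω => ?_]
    rw [Finset.prod_filter, Fintype.prod_option]
    by_cases h : a = j
    · subst h
      simp [mul_comm]
    · simp [h, Function.update_of_ne (Ne.symm h)]

lemma cycleSum_remove (f : ι → Ω → ℝ) (k : ι) :
    cycleSum μ f = -(∫ ω, f k ω ∂μ) * cycleSum μ (fun i : {i // i ≠ k} => f i) +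
      ∑ a : {i // i ≠ k}, cycleSum μ
        (Function.update (fun i : {i // i ≠ k} => f i) a fun ω => f a ω * f k ω) := by
  rw [← cycleSum_comp_equiv μ (Equiv.optionSubtypeNe k) f, cycleSum_option]
  simp

lemma permE_update (f : ι → Ω → ℝ) (k : ι) (σ : Equiv.Perm ι) :
    ∃ (A : Finset ι) (c : ℝ), k ∉ A ∧ ∀ h : Ω → ℝ,
      permE μ (Function.update f k h) σ = (∫ ω, h ω * ∏ i ∈ A, f i ω ∂μ) * c := by
  set O := Finset.univ.filter fun y => σ.SameCycle k y with hO
  have hOmem : O ∈ permOrbits σ := mem_permOrbits.2 ⟨k, rfl⟩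
  have hkO : k ∈ O := by simp [hO, Equiv.Perm.SameCycle.refl]
  refine ⟨O.erase k, ∏ Q ∈ (permOrbits σ).erase O, ∫ ω, ∏ i ∈ Q, f i ω ∂μ, by simp, fun h => ?_⟩
  unfold permE
  rw [← Finset.mul_prod_erase _ _ hOmem]
  congr 1
  · congr 1
    ext ω
    rw [← Finset.mul_prod_erase _ _ hkO, Function.update_self]
    congr 1
    refine Finset.prod_congr rfl fun i hi => ?_
    rw [Function.update_of_ne (Finset.ne_of_mem_erase hi)]
  · refine Finset.prod_congr rfl fun Q hQ => ?_
    have hk : k ∉ Q := by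
      intro hk
      refine Finset.ne_of_mem_erase hQ ?_
      obtain ⟨x, rfl⟩ := mem_permOrbits.1 (Finset.mem_of_mem_erase hQ)
      have hxk : σ.SameCycle x k := by simpa using hk
      ext y
      simp only [hO, Finset.mem_filter, Finset.mem_univ, true_and]
      exact ⟨fun h => hxk.symm.trans h, fun h => hxk.trans h⟩
    congr 1
    ext ω
    refine Finset.prod_congr rfl fun i hi => ?_
    rw [Function.update_of_ne fun hik : i = k => hk (hik ▸ hi)]

lemma cycleSum_update_linear (f : ι → Ω → ℝ) (k : ι) (h h₁ h₂ : Ω → ℝ) (a b : ℝ)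
    (H : ∀ A : Finset ι, k ∉ A → ∫ ω, h ω * ∏ i ∈ A, f i ω ∂μ =
      a * ∫ ω, h₁ ω * ∏ i ∈ A, f i ω ∂μ + b * ∫ ω, h₂ ω * ∏ i ∈ A, f i ω ∂μ) :
    cycleSum μ (Function.update f k h) =
      a * cycleSum μ (Function.update f k h₁) + b * cycleSum μ (Function.update f k h₂) := by
  unfold cycleSum
  rw [Finset.mul_sum, Finset.mul_sum, ← Finset.sum_add_distrib]
  refine Finset.sum_congr rfl fun σ _ => ?_
  obtain ⟨A, c, hA, hc⟩ := permE_update μ f k σ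
  rw [hc, hc, hc, H A hA]
  ring

lemma cycleSum_eq_zero_of_eq_zero (f : ι → Ω → ℝ) (k : ι) (hk : f k = 0) : cycleSum μ f = 0 := by
  have := cycleSum_update_linear μ f k 0 0 0 0 0 (by simp)
  rw [← hk, Function.update_eq_self] at this
  simpa using this

lemma cycleSum_congr_ae {f g : ι → Ω → ℝ} (h : ∀ i, f i =ᵐ[μ] g i) :
    cycleSum μ f = cycleSum μ g := by
  unfold cycleSum permE
  refine Finset.sum_congr rfl fun σ _ => ?_
  congr 1
  refine Finset.prod_congr rfl fun O _ => integral_congr_ae ?_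
  filter_upwards [ae_all_iff.2 h] with ω hω
  exact Finset.prod_congr rfl fun i _ => hω i

lemma cycleSum_comp_measurePreserving {Ω' : Type*} [MeasurableSpace Ω'] {ν : Measure Ω'}
    {e : Ω → Ω'} (he : MeasurePreserving e μ ν) (he' : MeasurableEmbedding e)
    (f : ι → Ω' → ℝ) : cycleSum μ (fun i ω => f i (e ω)) = cycleSum ν f := by
  unfold cycleSum permE
  refine Finset.sum_congr rfl fun σ _ => ?_
  congr 1
  exact Finset.prod_congr rfl fun O _ => he.integral_comp he' fun z => ∏ i ∈ O, f i z

lemma En_eq_neg_cycleSum [Nonempty ι] (f : ι → Ω → ℝ) : En μ f = -cycleSum μ f := by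
  unfold En cycleSum
  rw [← Finset.sum_neg_distrib]
  refine Finset.sum_congr rfl fun σ _ => ?_
  have : 0 < (permOrbits σ).card :=
    Finset.card_pos.2 ((Finset.univ_nonempty (α := ι)).image _)
  obtain ⟨c, hc⟩ := Nat.exists_eq_succ_of_ne_zero this.ne'
  rw [hc, Nat.succ_eq_add_one, Nat.add_sub_cancel, pow_succ]
  ring

end Permutations

section Staircases

set_option linter.unusedSectionVars false

/-- The indicator function of the complement of the union of the open quadrants with
lower left corners in `P`. -/
noncomputable def stair (P : Finset (ℝ × ℝ)) (z : ℝ × ℝ) : ℝ :=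
  open scoped Classical in if ∃ p ∈ P, p.1 < z.1 ∧ p.2 < z.2 then 0 else 1

/-- The points of `C` carrying the label `k`. -/
noncomputable def layer {ι : Type} [DecidableEq ι] (C : Finset (ι × ℝ × ℝ)) (k : ι) :
    Finset (ℝ × ℝ) :=
  (C.filter fun c => c.1 = k).image Prod.snd

variable {ι : Type} [Fintype ι] [DecidableEq ι]

lemma mem_layer {C : Finset (ι × ℝ × ℝ)} {k : ι} {p : ℝ × ℝ} : p ∈ layer C k ↔ (k, p) ∈ C := by
  simp [layer]

lemma layer_insert_self (C : Finset (ι × ℝ × ℝ)) (k : ι) (q : ℝ × ℝ) :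
    layer (insert (k, q) C) k = insert q (layer C k) := by
  ext p; simp [mem_layer]

lemma layer_insert_of_ne (C : Finset (ι × ℝ × ℝ)) {i k : ι} (h : i ≠ k) (q : ℝ × ℝ) :
    layer (insert (k, q) C) i = layer C i := by
  ext p; simp [mem_layer, h]

lemma stair_nonneg (P : Finset (ℝ × ℝ)) (z : ℝ × ℝ) : 0 ≤ stair P z := by
  unfold stair; split_ifs <;> norm_num

lemma stair_le_one (P : Finset (ℝ × ℝ)) (z : ℝ × ℝ) : stair P z ≤ 1 := by
  unfold stair; split_ifs <;> norm_num

lemma stair_empty : stair ∅ = 1 := by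
  ext z; simp [stair]

lemma stair_insert_le (P : Finset (ℝ × ℝ)) (q z : ℝ × ℝ) : stair (insert q P) z ≤ stair P z := by
  unfold stair
  split_ifs with h₁ h₂ h₂
  · exact le_rfl
  · norm_num
  · obtain ⟨p, hp, h⟩ := h₂
    exact absurd ⟨p, Finset.mem_insert_of_mem hp, h⟩ h₁
  · exact le_rfl

lemma measurable_stair (P : Finset (ℝ × ℝ)) : Measurable (stair P) := by
  classical
  have : MeasurableSet {z : ℝ × ℝ | ∃ p ∈ P, p.1 < z.1 ∧ p.2 < z.2} := by
    have : {z : ℝ × ℝ | ∃ p ∈ P, p.1 < z.1 ∧ p.2 < z.2} =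
        ⋃ p ∈ P, Set.Ioi p.1 ×ˢ Set.Ioi p.2 := by
      ext z; simp only [Set.mem_ofPred_eq, Set.mem_iUnion, Set.mem_prod, Set.mem_Ioi, exists_prop]
    rw [this]
    exact P.measurableSet_biUnion fun p _ => measurableSet_Ioi.prod measurableSet_Ioi
  exact Measurable.ite this measurable_const measurable_const

lemma stair_mul_sub_eq_zero {P Q : Finset (ℝ × ℝ)} {p q : ℝ × ℝ} (hp : p ∈ P) (hpq : p ≤ q)
    (z : ℝ × ℝ) : stair P z * (stair Q z - stair (insert q Q) z) = 0 := by
  classical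
  by_cases h : q.1 < z.1 ∧ q.2 < z.2
  · have : stair P z = 0 :=
      if_pos ⟨p, hp, hpq.1.trans_lt h.1, hpq.2.trans_lt h.2⟩
    simp [this]
  · have : stair (insert q Q) z = stair Q z := by
      unfold stair
      simp [h]
    simp [this]

variable (μ ν : Measure ℝ) [IsProbabilityMeasure μ] [IsProbabilityMeasure ν]

lemma integrable_stair_mul_prod (m : Measure (ℝ × ℝ)) [IsFiniteMeasure m]
    (P : Finset (ℝ × ℝ)) (Q : ι → Finset (ℝ × ℝ)) (A : Finset ι) :
    Integrable (fun z => stair P z * ∏ i ∈ A, stair (Q i) z) m := by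
  refine Integrable.of_bound (C := 1) ?_ (Filter.Eventually.of_forall fun z => ?_)
  · exact ((measurable_stair P).mul
      (Finset.measurable_fun_prod A fun i _ => measurable_stair (Q i))).aestronglyMeasurable
  · have h0 : 0 ≤ ∏ i ∈ A, stair (Q i) z := Finset.prod_nonneg fun i _ => stair_nonneg _ _
    rw [Real.norm_of_nonneg (mul_nonneg (stair_nonneg _ _) h0)]
    exact mul_le_one₀ (stair_le_one _ _) h0
      (Finset.prod_le_one (fun i _ => stair_nonneg _ _) fun i _ => stair_le_one _ _)

/-- To the right of all the points of `C`, the staircases of `C` do not depend on the first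
coordinate, so a quadrant at `(t, y)` is felt only through the mass of `(t, ∞)`. -/
lemma integral_stair_insert (C : Finset (ι × ℝ × ℝ)) (k : ι) (t y : ℝ)
    (A : Finset ι) (ht : ∀ c ∈ C, c.2.1 ≤ t) :
    ∫ z, stair (insert (t, y) (layer C k)) z * ∏ i ∈ A, stair (layer C i) z ∂(μ.prod ν) =
      ∫ z, stair (layer C k) z * ∏ i ∈ A, stair (layer C i) z ∂(μ.prod ν) -
        μ.real (Set.Ioi t) * ∫ v, (Set.Ioi y).indicator (fun _ => 1) v *
          ((open scoped Classical in if ∃ p ∈ layer C k, p.2 < v then 0 else 1) *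
            ∏ i ∈ A, open scoped Classical in if ∃ p ∈ layer C i, p.2 < v then 0 else 1) ∂ν := by
  classical
  have hμ : μ.real (Set.Ioi t) = ∫ u, (Set.Ioi t).indicator (fun _ => (1 : ℝ)) u ∂μ := by
    rw [integral_indicator_const _ measurableSet_Ioi]
    simp
  rw [hμ, ← integral_prod_mul, eq_sub_iff_add_eq, ← eq_sub_iff_add_eq',
    ← integral_sub (integrable_stair_mul_prod _ _ _ _) (integrable_stair_mul_prod _ _ _ _)]
  congr 1
  ext z
  by_cases hz : t < z.1
  · have key : ∀ i, stair (layer C i) z = if ∃ p ∈ layer C i, p.2 < z.2 then 0 else 1 := by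
      intro i
      unfold stair
      refine if_congr (exists_congr fun p => and_congr_right fun hp => ?_) rfl rfl
      exact and_iff_right ((ht _ (mem_layer.1 hp)).trans_lt hz)
    simp only [← key]
    by_cases hy : y < z.2
    · have : stair (insert (t, y) (layer C k)) z = 0 :=
        if_pos ⟨_, Finset.mem_insert_self _ _, hz, hy⟩
      simp [this, hz, hy]
    · have : stair (insert (t, y) (layer C k)) z = stair (layer C k) z := by
        simp [stair, hy]
      simp [this, hy]
  · have : stair (insert (t, y) (layer C k)) z = stair (layer C k) z := by
      simp [stair, hz]
    simp [this, hz]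

/-- Nonpositivity of `cycleSum` for staircase functions indexed by `n` labels. -/
def StairNonpos (n : ℕ) : Prop :=
  ∀ (κ : Type) [Fintype κ] [DecidableEq κ] (P : κ → Finset (ℝ × ℝ)), Nonempty κ →
    Fintype.card κ = n → cycleSum (μ.prod ν) (fun i => stair (P i)) ≤ 0

lemma card_ne_add_one (k : ι) : Fintype.card {i // i ≠ k} + 1 = Fintype.card ι := by
  have := Fintype.card_pos_iff.2 ⟨k⟩
  rw [Fintype.card_subtype_compl, Fintype.card_subtype_eq]
  omega

lemma cycleSum_nonneg_of_mul_eq_zero (n : ℕ) (hn : ∀ j < n, StairNonpos μ ν j) :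
    ∀ (κ : Type) [Fintype κ] [DecidableEq κ] (f : κ → ℝ × ℝ → ℝ) (k l : κ),
      Fintype.card κ = n → l ≠ k → (∀ i, i ≠ k → ∃ P, f i = stair P) → (∀ z, 0 ≤ f k z) →
      (∀ z, f l z * f k z = 0) → 0 ≤ cycleSum (μ.prod ν) f := by
  induction n with
  | zero =>
    intro κ _ _ f k l hκ
    exact absurd hκ (Fintype.card_pos_iff.2 ⟨k⟩).ne'
  | succ n ih =>
    intro κ _ _ f k l hκ hlk hf hk hl
    have hcard : Fintype.card {i // i ≠ k} = n := by
      have := card_ne_add_one k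
      omega
    choose! P hP using hf
    rw [cycleSum_remove _ f k]
    refine add_nonneg ?_ (Finset.sum_nonneg fun a _ => ?_)
    · rw [neg_mul, ← mul_neg]
      refine mul_nonneg (integral_nonneg hk) (neg_nonneg.2 ?_)
      have : (fun i : {i // i ≠ k} => f i) = fun i : {i // i ≠ k} => stair (P i) :=
        funext fun i => hP i i.2
      rw [this]
      exact hn n n.lt_succ_self _ _ ⟨⟨l, hlk⟩⟩ hcard
    · by_cases hla : a = ⟨l, hlk⟩
      · subst hla
        refine (cycleSum_eq_zero_of_eq_zero _ _ ⟨l, hlk⟩ ?_).ge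
        ext z
        simp [hl]
      · have hal : (⟨l, hlk⟩ : {i // i ≠ k}) ≠ a := Ne.symm hla
        refine ih (fun j hj => hn j (hj.trans n.lt_succ_self)) _ _ a ⟨l, hlk⟩ hcard hal ?_ ?_ ?_
        · intro i hi
          exact ⟨P i, by rw [Function.update_of_ne hi, hP i i.2]⟩
        · intro z
          rw [Function.update_self]
          refine mul_nonneg ?_ (hk z)
          rw [hP a a.2]
          exact stair_nonneg _ _
        · intro z
          rw [Function.update_self, Function.update_of_ne hal]
          change f l z * (f a z * f k z) = 0
          rw [mul_left_comm, hl, mul_zero]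

lemma stair_layer_insert (C : Finset (ι × ℝ × ℝ)) (k : ι) (q : ℝ × ℝ) :
    (fun i => stair (layer (insert (k, q) C) i)) =
      Function.update (fun i => stair (layer C i)) k (stair (insert q (layer C k))) := by
  ext i : 1
  by_cases h : i = k
  · subst h
    rw [Function.update_self, layer_insert_self]
  · rw [Function.update_of_ne h, layer_insert_of_ne C h]

lemma cycleSum_insert_le (hn : ∀ j < Fintype.card ι, StairNonpos μ ν j)
    (C : Finset (ι × ℝ × ℝ)) (k i : ι) (p q : ℝ × ℝ) (hp : (i, p) ∈ C) (hpq : p ≤ q) :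
    cycleSum (μ.prod ν) (fun i => stair (layer (insert (k, q) C) i)) ≤
      cycleSum (μ.prod ν) (fun i => stair (layer C i)) := by
  set f := fun i => stair (layer C i) with hf
  set h : ℝ × ℝ → ℝ := fun z => stair (layer C k) z - stair (insert q (layer C k)) z with hh
  have hsplit := cycleSum_update_linear (μ.prod ν) f k (stair (layer C k))
    (stair (insert q (layer C k))) h 1 1 fun A _ => by
      have h1 := integrable_stair_mul_prod (μ.prod ν) (layer C k) (layer C) A
      have h2 := integrable_stair_mul_prod (μ.prod ν) (insert q (layer C k)) (layer C) A
      have : ∀ z, h z * ∏ i ∈ A, f i z = stair (layer C k) z * ∏ i ∈ A, stair (layer C i) z -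
          stair (insert q (layer C k)) z * ∏ i ∈ A, stair (layer C i) z := fun z => by
        simp only [hh, hf, sub_mul]
      simp only [this]
      rw [integral_sub h1 h2]
      ring
  have hself : Function.update f k (stair (layer C k)) = f := Function.update_eq_self k f
  rw [hself, one_mul, one_mul] at hsplit
  rw [stair_layer_insert, hsplit]
  refine le_add_of_nonneg_right ?_
  have hzero : ∀ z, stair (layer C i) z * h z = 0 := fun z =>
    stair_mul_sub_eq_zero (mem_layer.2 hp) hpq z
  by_cases hik : i = k
  · subst hik
    refine (cycleSum_eq_zero_of_eq_zero _ _ i ?_).ge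
    rw [Function.update_self]
    ext z
    have hz := hzero z
    have h1 := stair_nonneg (insert q (layer C i)) z
    have h2 := stair_insert_le (layer C i) q z
    rcases mul_eq_zero.1 hz with h0 | h0
    · simp only [hh, Pi.zero_apply]
      linarith
    · exact h0
  · refine cycleSum_nonneg_of_mul_eq_zero μ ν _ hn ι _ k i rfl hik ?_ ?_ ?_
    · intro j hj
      exact ⟨layer C j, by rw [Function.update_of_ne hj]⟩
    · intro z
      rw [Function.update_self]
      exact sub_nonneg.2 (stair_insert_le _ _ _)
    · intro z
      rw [Function.update_self, Function.update_of_ne hik]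
      exact hzero z

lemma cycleSum_of_eq_one (f : ι → ℝ × ℝ → ℝ) (k : ι) (hk : f k = 1) :
    cycleSum (μ.prod ν) f =
      ((Fintype.card ι : ℝ) - 2) * cycleSum (μ.prod ν) (fun i : {i // i ≠ k} => f i) := by
  rw [cycleSum_remove _ f k]
  simp only [hk, ← card_ne_add_one k]
  simp
  ring

/-- Sliding the rightmost labelled point horizontally changes `cycleSum` affinely. -/
lemma cycleSum_slide (C : Finset (ι × ℝ × ℝ)) (k : ι) (t t' y : ℝ) (htt' : t' ≤ t)
    (ht' : ∀ c ∈ C, c.2.1 ≤ t') :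
    ∃ s ∈ Set.Icc (0 : ℝ) 1,
      cycleSum (μ.prod ν) (fun i => stair (layer (insert (k, t, y) C) i)) =
        s * cycleSum (μ.prod ν) (fun i => stair (layer (insert (k, t', y) C) i)) +
          (1 - s) * cycleSum (μ.prod ν) (fun i => stair (layer C i)) := by
  have hle : μ.real (Set.Ioi t) ≤ μ.real (Set.Ioi t') :=
    measureReal_mono (Set.Ioi_subset_Ioi htt')
  obtain ⟨s, hs, hst⟩ : ∃ s ∈ Set.Icc (0 : ℝ) 1,
      μ.real (Set.Ioi t) = s * μ.real (Set.Ioi t') := by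
    rcases (measureReal_nonneg (μ := μ) (s := Set.Ioi t')).eq_or_lt with h0 | h0
    · exact ⟨0, by simp, by rw [zero_mul]; exact le_antisymm (h0 ▸ hle) measureReal_nonneg⟩
    · refine ⟨μ.real (Set.Ioi t) / μ.real (Set.Ioi t'),
        ⟨div_nonneg measureReal_nonneg h0.le, div_le_one_of_le₀ hle h0.le⟩, ?_⟩
      rw [div_mul_cancel₀ _ h0.ne']
  refine ⟨s, hs, ?_⟩
  have hself : Function.update (fun i => stair (layer C i)) k (stair (layer C k)) =
      fun i => stair (layer C i) := Function.update_eq_self k _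
  have hlin := cycleSum_update_linear (μ.prod ν) (fun i => stair (layer C i)) k
    (stair (insert (t, y) (layer C k))) (stair (insert (t', y) (layer C k)))
    (stair (layer C k)) s (1 - s) fun A _ => by
      rw [integral_stair_insert μ ν C k t y A fun c hc => (ht' c hc).trans htt',
        integral_stair_insert μ ν C k t' y A ht', hst]
      ring
  rw [hself] at hlin
  rw [stair_layer_insert, stair_layer_insert, hlin]

lemma cycleSum_layer_nonpos [Nonempty ι] (hn : ∀ j < Fintype.card ι, StairNonpos μ ν j) (N : ℕ) :
    ∀ C : Finset (ι × ℝ × ℝ), C.card = N →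
      cycleSum (μ.prod ν) (fun i => stair (layer C i)) ≤ 0 := by
  induction N using Nat.strong_induction_on with
  | _ N ih =>
  intro C hC
  by_cases hempty : ∃ k, layer C k = ∅
  · obtain ⟨k, hk⟩ := hempty
    rw [cycleSum_of_eq_one μ ν _ k (by rw [hk, stair_empty])]
    have hcard := card_ne_add_one k
    rcases isEmpty_or_nonempty {i // i ≠ k} with he | hne
    · have h0 : Fintype.card {i // i ≠ k} = 0 := Fintype.card_eq_zero
      have : cycleSum (μ.prod ν) (fun i : {i // i ≠ k} => stair (layer C i)) = 1 := by
        simp [cycleSum, permE, permOrbits]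
      rw [this, ← hcard, h0]
      norm_num
    · have h1 : 1 ≤ Fintype.card {i // i ≠ k} := Fintype.card_pos
      have h2 : (2 : ℝ) ≤ Fintype.card ι := by exact_mod_cast (by omega : 2 ≤ Fintype.card ι)
      exact mul_nonpos_of_nonneg_of_nonpos (by linarith)
        (hn _ (by omega) {i // i ≠ k} (fun i => layer C i) hne rfl)
  push Not at hempty
  obtain ⟨k₀⟩ := ‹Nonempty ι›
  obtain ⟨q₀, hq₀⟩ := hempty k₀
  obtain ⟨⟨k, x, y⟩, hkC, hmax⟩ :=
    C.exists_max_image (fun c => c.2.1) ⟨_, mem_layer.1 hq₀⟩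
  set D := C.erase (k, x, y) with hD
  have hCD : insert (k, x, y) D = C := Finset.insert_erase hkC
  have hDcard : D.card + 1 = N := by rw [← hC]; exact Finset.card_erase_add_one hkC
  have hDnonpos := ih D.card (by omega) D rfl
  rcases D.eq_empty_or_nonempty with hD0 | hDne
  · have hall : ∀ i, i = k := by
      intro i
      obtain ⟨p, hp⟩ := hempty i
      have := mem_layer.1 hp
      rw [← hCD, hD0] at this
      simp only [insert_empty_eq, Finset.mem_singleton, Prod.mk.injEq] at this
      exact this.1
    have : IsEmpty {i // i ≠ k} := ⟨fun i => i.2 (hall i)⟩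
    rw [cycleSum_remove _ _ k]
    have h1 : cycleSum (μ.prod ν) (fun i : {i // i ≠ k} => stair (layer C i)) = 1 := by
      simp [cycleSum, permE, permOrbits]
    rw [h1]
    simpa using integral_nonneg (stair_nonneg (layer C k))
  obtain ⟨⟨j, x', y'⟩, hjD, hmax'⟩ := D.exists_max_image (fun c => c.2.1) hDne
  have hx : x' ≤ x := hmax _ (Finset.mem_of_mem_erase hjD)
  rcases le_or_gt y' y with hy | hy
  · rw [← hCD]
    exact (cycleSum_insert_le μ ν hn D k j (x', y') (x, y) hjD ⟨hx, hy⟩).trans hDnonpos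
  obtain ⟨s, hs, hslide⟩ := cycleSum_slide μ ν D k x x' y hx hmax'
  rw [← hCD, hslide]
  refine add_nonpos (mul_nonpos_of_nonneg_of_nonpos hs.1 ?_)
    (mul_nonpos_of_nonneg_of_nonpos (sub_nonneg.2 hs.2) hDnonpos)
  have hDB : insert (k, x', y) D = insert (j, x', y') (insert (k, x', y) (D.erase (j, x', y'))) := by
    rw [Finset.insert_comm, Finset.insert_erase hjD]
  rw [hDB]
  refine (cycleSum_insert_le μ ν hn _ j k (x', y) (x', y') (Finset.mem_insert_self _ _)
    ⟨le_rfl, hy.le⟩).trans (ih _ ?_ _ rfl)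
  have h1 := Finset.card_insert_le (k, x', y) (D.erase (j, x', y'))
  have h2 := Finset.card_erase_add_one hjD
  omega

lemma stairNonpos (n : ℕ) : StairNonpos μ ν n := by
  induction n using Nat.strong_induction_on with
  | _ n ih =>
  intro κ _ _ P hκ hcard
  subst hcard
  set C : Finset (κ × ℝ × ℝ) :=
    Finset.univ.biUnion fun i => (P i).image fun p => (i, p) with hC
  have hlayer : ∀ i, layer C i = P i := by
    intro i
    ext p
    simp [mem_layer, hC]
  have := cycleSum_layer_nonpos μ ν ih _ C rfl
  simpa only [hlayer] using this

end Staircases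

section UnitSquare

/-- The staircase corners attached to a sequence in `A(m)`. -/
noncomputable def gridCorners (m : ℕ) (a : Fin m → ℤ) : Finset (ℝ × ℝ) :=
  Finset.univ.image fun i : Fin m => ((i.val : ℝ) / m, (a i : ℝ) / m)

lemma stair_gridCorners {m : ℕ} (hm : 1 ≤ m) {a : Fin m → ℤ} (ha : memA m a) {z : Fin 2 → ℝ}
    (hz : z ≤ 1) (h0 : 0 < z 0) (h1 : 0 < z 1) :
    (Sa m a).indicator (fun _ => (1 : ℝ)) z = stair (gridCorners m a) (z 0, z 1) := by
  classical
  have hm0 : (0 : ℝ) < m := by exact_mod_cast hm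
  have hcorner : (∃ p ∈ gridCorners m a, p.1 < z 0 ∧ p.2 < z 1) ↔
      ∃ i : Fin m, (i.val : ℝ) < z 0 * m ∧ (a i : ℝ) < z 1 * m := by
    simp [gridCorners, div_lt_iff₀ hm0]
  have hSa : z ∈ Sa m a ↔ ∃ i j : Fin m, (j.val : ℤ) + 1 ≤ a i ∧
      ((i.val : ℝ) ≤ z 0 * m ∧ (j.val : ℝ) ≤ z 1 * m) ∧
      (z 0 * m ≤ i.val + 1 ∧ z 1 * m ≤ j.val + 1) := by
    simp [Sa, Pi.le_def, Fin.forall_fin_two, div_le_iff₀ hm0, le_div_iff₀ hm0]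
    exact exists_congr fun i => exists_congr fun j => by tauto
  have hceil : ∀ t : ℝ, 0 < t → t ≤ 1 → ∃ i : Fin m, (i.val : ℝ) < t * m ∧ t * m ≤ i.val + 1 := by
    intro t ht ht1
    have hpos : 0 < t * m := mul_pos ht hm0
    have hc : 0 < ⌈t * m⌉₊ := Nat.ceil_pos.2 hpos
    have hcm : ⌈t * m⌉₊ ≤ m := Nat.ceil_le.2 (by nlinarith)
    have hcast : ((⌈t * m⌉₊ - 1 : ℕ) : ℝ) = (⌈t * m⌉₊ : ℝ) - 1 := by
      rw [Nat.cast_sub hc, Nat.cast_one]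
    refine ⟨⟨⌈t * m⌉₊ - 1, by omega⟩, ?_, ?_⟩
    · have := Nat.ceil_lt_add_one hpos.le
      simp only [hcast]
      linarith
    · have := Nat.le_ceil (t * m)
      simp only [hcast]
      linarith
  obtain ⟨-, -, hanti⟩ := ha
  have key : z ∈ Sa m a ↔ ¬ ∃ p ∈ gridCorners m a, p.1 < z 0 ∧ p.2 < z 1 := by
    rw [hcorner, hSa]
    constructor
    · rintro ⟨i, j, hja, ⟨-, -⟩, hi, hj⟩ ⟨i', hi', ha'⟩
      have hii : i'.val < i.val + 1 := by exact_mod_cast hi'.trans_le hi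
      have hle : a i ≤ a i' := hanti (Fin.le_def.2 (by omega))
      have : ((j.val : ℤ) : ℝ) + 1 ≤ (a i' : ℝ) := by exact_mod_cast hja.trans hle
      push_cast at this
      linarith
    · intro h
      push Not at h
      obtain ⟨i, hi, hi'⟩ := hceil (z 0) h0 (hz 0)
      obtain ⟨j, hj, hj'⟩ := hceil (z 1) h1 (hz 1)
      refine ⟨i, j, ?_, ⟨hi.le, hj.le⟩, hi', hj'⟩
      have : ((j.val : ℤ) : ℝ) < (a i : ℝ) := by
        push_cast
        exact hj.trans_le (h i hi)
      exact_mod_cast this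
  by_cases h : z ∈ Sa m a
  · rw [Set.indicator_of_mem h, stair, if_neg (key.1 h)]
  · rw [Set.indicator_of_notMem h, stair, if_pos (not_not.1 fun h' => h (key.2 h'))]

lemma measurePreserving_unitSquare :
    MeasurePreserving (MeasurableEquiv.finTwoArrow (α := ℝ))
      (volume.restrict (Set.Icc (0 : Fin 2 → ℝ) 1))
      ((volume.restrict (Set.Icc (0 : ℝ) 1)).prod (volume.restrict (Set.Icc (0 : ℝ) 1))) := by
  have h := (volume_preserving_finTwoArrow ℝ).restrict_preimage
    ((measurableSet_Icc (a := (0 : ℝ)) (b := 1)).prod (measurableSet_Icc (a := (0 : ℝ)) (b := 1)))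
  rw [Measure.prod_restrict]
  have hpre : MeasurableEquiv.finTwoArrow ⁻¹' (Set.Icc (0 : ℝ) 1 ×ˢ Set.Icc (0 : ℝ) 1) =
      Set.Icc (0 : Fin 2 → ℝ) 1 := by
    ext z
    change (0 ≤ z 0 ∧ z 0 ≤ 1) ∧ (0 ≤ z 1 ∧ z 1 ≤ 1) ↔ 0 ≤ z ∧ z ≤ 1
    simp only [Pi.le_def, Fin.forall_fin_two, Pi.zero_apply, Pi.one_apply]
    tauto
  rwa [hpre] at h

lemma ae_pos_unitSquare :
    ∀ᵐ z ∂(volume.restrict (Set.Icc (0 : Fin 2 → ℝ) 1)), z ≤ 1 ∧ 0 < z 0 ∧ 0 < z 1 := by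
  have hne : ∀ i : Fin 2, ∀ᵐ z ∂(volume.restrict (Set.Icc (0 : Fin 2 → ℝ) 1)), z i ≠ 0 :=
    fun i => ae_restrict_of_ae (Measure.ae_eval_ne (fun _ : Fin 2 => (volume : Measure ℝ)) i 0)
  filter_upwards [hne 0, hne 1, ae_restrict_mem measurableSet_Icc] with z h0 h1 hz
  exact ⟨hz.2, lt_of_le_of_ne (hz.1 0) h0.symm, lt_of_le_of_ne (hz.1 1) h1.symm⟩

end UnitSquare

/-- Let `a¹,…,aⁿ⁻²,b ∈ A(m)` (here there are `n + 2` functions in all: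
`g = (a¹,…,aⁿ⁻²)`, `b`, and `χ_S`), and let `S ⊆ [0,1]²` be Lebesgue-measurable with
`S ∩ S_b = ∅` (so `χ_b χ_S = 0`).  Then, for Lebesgue measure on `[0,1]²`,
`E_n(χ_{a¹},…,χ_{aⁿ⁻²},χ_b,χ_S) ≤ 0`. -/
theorem stmt_14 (m : ℕ) (hm : 1 ≤ m) (n : ℕ)
    (g : Fin n → Fin m → ℤ) (hg : ∀ l, memA m (g l))
    (b : Fin m → ℤ) (hb : memA m b)
    (S : Set (Fin 2 → ℝ)) (hSmeas : MeasurableSet S)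
    (hSsub : S ⊆ Set.Icc (0 : Fin 2 → ℝ) 1)
    (hdisj : S ∩ Sa m b = ∅) :
    En (volume.restrict (Set.Icc (0 : Fin 2 → ℝ) 1))
        (Fin.snoc
          (Fin.snoc (fun l => (Sa m (g l)).indicator fun _ => (1 : ℝ))
            ((Sa m b).indicator fun _ => (1 : ℝ)))
          (S.indicator fun _ => (1 : ℝ)))
      ≤ 0 := by
  classical
  have hprob : IsProbabilityMeasure (volume.restrict (Set.Icc (0 : ℝ) 1)) := ⟨by simp⟩
  rw [En_eq_neg_cycleSum, neg_nonpos]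
  set T : Set (ℝ × ℝ) := {w | ![w.1, w.2] ∈ S ∧ ![w.1, w.2] ≤ 1 ∧ 0 < w.1 ∧ 0 < w.2} with hT
  set F : Fin (n + 2) → ℝ × ℝ → ℝ :=
    Fin.snoc (Fin.snoc (fun l => stair (gridCorners m (g l))) (stair (gridCorners m b)))
      (T.indicator fun _ => 1) with hF
  have hlast : F (Fin.last (n + 1)) = T.indicator fun _ => 1 := by simp [hF]
  have hb' : F (Fin.last n).castSucc = stair (gridCorners m b) := by simp [hF]
  have hg' : ∀ l : Fin n, F l.castSucc.castSucc = stair (gridCorners m (g l)) := by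
    intro l
    simp [hF]
  have hvec : ∀ z : Fin 2 → ℝ, ![z 0, z 1] = z := fun z => by
    ext i; fin_cases i <;> rfl
  have hF_ae : cycleSum (volume.restrict (Set.Icc (0 : Fin 2 → ℝ) 1))
      (Fin.snoc
          (Fin.snoc (fun l => (Sa m (g l)).indicator fun _ => (1 : ℝ))
            ((Sa m b).indicator fun _ => (1 : ℝ)))
          (S.indicator fun _ => (1 : ℝ))) =
      cycleSum (volume.restrict (Set.Icc (0 : Fin 2 → ℝ) 1))
        (fun i z => F i (MeasurableEquiv.finTwoArrow z)) := by
    refine cycleSum_congr_ae _ fun i => ?_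
    filter_upwards [ae_pos_unitSquare] with z ⟨hz, h0, h1⟩
    change _ = F i (z 0, z 1)
    induction i using Fin.lastCases with
    | last =>
      rw [hlast, Fin.snoc_last]
      simp [Set.indicator_apply, hT, hvec, hz, h0, h1]
    | cast i =>
      rw [Fin.snoc_castSucc]
      induction i using Fin.lastCases with
      | last => rw [hb', Fin.snoc_last, stair_gridCorners hm hb hz h0 h1]
      | cast i => rw [hg', Fin.snoc_castSucc, stair_gridCorners hm (hg i) hz h0 h1]
  rw [hF_ae, cycleSum_comp_measurePreserving _ measurePreserving_unitSquare
    (MeasurableEquiv.measurableEmbedding _)]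
  refine cycleSum_nonneg_of_mul_eq_zero _ _ (n + 2) (fun j _ => stairNonpos _ _ j) _ F
    (Fin.last (n + 1)) (Fin.last n).castSucc (by simp) (Fin.castSucc_lt_last _).ne ?_ ?_ ?_
  · intro i hi
    induction i using Fin.lastCases with
    | last => exact absurd rfl hi
    | cast i =>
      induction i using Fin.lastCases with
      | last => exact ⟨_, hb'⟩
      | cast i => exact ⟨_, hg' i⟩
  · intro w
    rw [hlast]
    exact Set.indicator_nonneg (fun _ _ => zero_le_one) w
  · intro w
    rw [hlast, hb']
    by_cases hw : w ∈ T
    · have hnot : ![w.1, w.2] ∉ Sa m b := fun h =>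
        (Set.eq_empty_iff_forall_notMem.1 hdisj) _ ⟨hw.1, h⟩
      have := stair_gridCorners hm hb (z := ![w.1, w.2]) hw.2.1 hw.2.2.1 hw.2.2.2
      rw [Set.indicator_of_notMem hnot] at this
      have h0 : stair (gridCorners m b) w = 0 := this.symm
      rw [h0, zero_mul]
    · rw [Set.indicator_of_notMem hw, mul_zero]
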